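/- Let n ≥ 2 and let α_1, ..., α_{n-1} be nonnegative integers with α_1 + α_2 + ... + α_{n-1} = n and 1·α_1 + 2·α_2 + ... + (n-1)·α_{n-1} = 2n - 2. Then the number of trees T on the vertex set {1, ..., n} such that, for each i ∈ {1, ..., n-1}, exactly α_i vertices of T have degree i, equals (n! / (α_1! α_2! ⋯ α_{n-1}!)) · ((n-2)! / ∏_{i=1}^{n-1} ((i-1)!)^{α_i}). -/

import Mathlib

/-- The number of functions whose fibres have prescribed sizes is a multinomial coefficient. -/
theorem card_functions_with_fiber_cards {V ι : Type*} [Fintype V] [Fintype ι] (α : ι → ℕ)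
    (h : ∑ i, α i = Fintype.card V) :
    Nat.card {f : V → ι // ∀ i, Nat.card {v // f v = i} = α i} * ∏ i, (α i).factorial =
      (Fintype.card V).factorial := by
  classical
  obtain ⟨e⟩ : Nonempty (V ≃ Σ i, Fin (α i)) := ⟨Fintype.equivOfCardEq (by simp [h])⟩
  let f₀ : V → ι := fun v ↦ (e v).1
  have hf₀ (i : ι) : Nat.card {v // f₀ v = i} = α i := by
    rw [Nat.card_congr ((e.subtypeEquiv (fun _ ↦ Iff.rfl)).trans (Equiv.sigmaSubtype i) :
      {v // f₀ v = i} ≃ Fin (α i)), Nat.card_fin]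
  have horbit : MulAction.orbit (Equiv.Perm V)ᵈᵐᵃ f₀ =
      {f : V → ι | ∀ i, Nat.card {v // f v = i} = α i} := by
    ext f
    constructor
    · rintro ⟨g, rfl⟩ i
      rw [← hf₀ i]
      exact Nat.card_congr ((DomMulAct.mk.symm g).subtypeEquiv fun v ↦ Iff.rfl)
    · intro hf
      have hfib (i : ι) : Nonempty ({v // f v = i} ≃ {v // f₀ v = i}) :=
        ⟨Fintype.equivOfCardEq (by
          simpa only [Nat.card_eq_fintype_card] using (hf i).trans (hf₀ i).symm)⟩
      let g : Equiv.Perm V := Equiv.ofFiberEquiv fun i ↦ (hfib i).some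
      refine ⟨DomMulAct.mk g, ?_⟩
      ext v
      exact Equiv.ofFiberEquiv_map (fun i ↦ (hfib i).some) v
  have hstab : Nat.card (MulAction.stabilizer (Equiv.Perm V)ᵈᵐᵃ f₀) = ∏ i, (α i).factorial := by
    rw [Nat.card_congr (DomMulAct.mk.symm.subtypeEquiv fun g ↦ DomMulAct.mem_stabilizer_iff :
      MulAction.stabilizer (Equiv.Perm V)ᵈᵐᵃ f₀ ≃ {g : Equiv.Perm V // f₀ ∘ g = f₀}),
      Nat.card_eq_fintype_card, DomMulAct.stabilizer_card f₀]
    simp_rw [← hf₀, Nat.card_eq_fintype_card]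
  have hcard := Nat.card_congr (MulAction.orbitProdStabilizerEquivGroup (Equiv.Perm V)ᵈᵐᵃ f₀)
  rw [Nat.card_prod, hstab, horbit, Nat.card_congr DomMulAct.mk.symm, Nat.card_perm,
    Nat.card_eq_fintype_card (α := V)] at hcard
  exact hcard

namespace SimpleGraph

variable {V : Type*}

/-- Attach the vertex `v` as a leaf to the vertex `w` of a graph on the complement of `v`. -/
def attachLeaf (v : V) (w : {x // x ≠ v}) (H : SimpleGraph {x // x ≠ v}) : SimpleGraph V where
  Adj a b := (∃ ha hb, H.Adj ⟨a, ha⟩ ⟨b, hb⟩) ∨ (a = v ∧ b = w) ∨ (a = w ∧ b = v)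
  symm := ⟨by
    rintro a b (⟨ha, hb, h⟩ | h | h)
    · exact .inl ⟨hb, ha, h.symm⟩
    · exact .inr (.inr h.symm)
    · exact .inr (.inl h.symm)⟩
  loopless := ⟨by
    rintro a (⟨ha, hb, h⟩ | ⟨h, h'⟩ | ⟨h, h'⟩)
    · exact h.ne rfl
    · exact w.2 (h'.symm.trans h)
    · exact w.2 (h.symm.trans h')⟩

variable {v : V} {w : {x // x ≠ v}} {H : SimpleGraph {x // x ≠ v}}

theorem comap_attachLeaf : (attachLeaf v w H).comap Subtype.val = H := by
  ext ⟨a, ha⟩ ⟨b, hb⟩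
  simp [attachLeaf, ha, hb]

theorem neighborSet_attachLeaf_self : (attachLeaf v w H).neighborSet v = {(w : V)} := by
  ext a
  have := w.2
  simp [attachLeaf, this.symm]

theorem neighborSet_attachLeaf_of_eq :
    (attachLeaf v w H).neighborSet w = insert v (Subtype.val '' H.neighborSet w) := by
  ext a
  have := w.2
  simp [attachLeaf, this]
  tauto

theorem neighborSet_attachLeaf_of_ne {x : {x // x ≠ v}} (hx : x ≠ w) :
    (attachLeaf v w H).neighborSet x = Subtype.val '' H.neighborSet x := by
  ext a
  have := x.2
  have hx' : (x : V) ≠ w := fun h ↦ hx (Subtype.ext h)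
  simp [attachLeaf, this, hx']

theorem ncard_neighborSet_attachLeaf [Finite V] [DecidableEq V] (x : {x // x ≠ v}) :
    ((attachLeaf v w H).neighborSet x).ncard =
      (H.neighborSet x).ncard + if x = w then 1 else 0 := by
  split_ifs with hx
  · rw [hx, neighborSet_attachLeaf_of_eq, Set.ncard_insert_of_notMem (by simp),
      Set.ncard_image_of_injective _ Subtype.val_injective]
  · rw [neighborSet_attachLeaf_of_ne hx, Set.ncard_image_of_injective _ Subtype.val_injective,
      add_zero]

theorem attachLeaf_connected (hH : H.Connected) : (attachLeaf v w H).Connected := by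
  have hw (x : {x // x ≠ v}) : (attachLeaf v w H).Reachable w x :=
    (hH.preconnected w x).map
      (⟨Subtype.val, fun {a b} h ↦ .inl ⟨a.2, b.2, h⟩⟩ : H →g attachLeaf v w H)
  refine (connected_iff_exists_forall_reachable _).2 ⟨w, fun x ↦ ?_⟩
  by_cases hx : x = v
  · exact Adj.reachable (.inr (.inr ⟨rfl, hx⟩))
  · exact hw ⟨x, hx⟩

theorem attachLeaf_comap {G : SimpleGraph V} (hv : G.neighborSet v = {(w : V)}) :
    attachLeaf v w (G.comap Subtype.val) = G := by
  have hva (a : V) : G.Adj v a ↔ a = w := by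
    rw [← mem_neighborSet, hv, Set.mem_singleton_iff]
  have hw := w.2
  ext a b
  by_cases ha : a = v
  · subst ha
    simp [attachLeaf, hva, hw.symm]
  · by_cases hb : b = v
    · subst hb
      simp [attachLeaf, G.adj_comm a, hva, hw.symm]
    · simp [attachLeaf, ha, hb]

theorem Connected.comap_of_neighborSet_eq_singleton {G : SimpleGraph V} (hG : G.Connected)
    (hv : G.neighborSet v = {(w : V)}) :
    (G.comap (Subtype.val : {x // x ≠ v} → V)).Connected := by
  classical
  have : Fintype (G.neighborSet v) := by rw [hv]; infer_instance
  refine hG.induce_compl_singleton_of_degree_eq_one (v := v) ?_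
  rw [degree_eq_one_iff_existsUnique_adj]
  refine ⟨w, ?_, fun y hy ↦ ?_⟩
  · simp [← mem_neighborSet, hv]
  · simpa [← mem_neighborSet, hv] using hy

/-- Removing a leaf is a bijection onto connected graphs on the remaining vertices. -/
def connectedLeafEquiv [Finite V] [DecidableEq V] (v : V) (w : {x // x ≠ v}) (d : V → ℕ)
    (hd : d v = 0) :
    {G : SimpleGraph V // (G.Connected ∧ ∀ x, (G.neighborSet x).ncard = d x + 1) ∧
      G.neighborSet v = {(w : V)}} ≃
    {H : SimpleGraph {x // x ≠ v} // H.Connected ∧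
      ∀ x, (H.neighborSet x).ncard + (if x = w then 1 else 0) = d x + 1} where
  toFun G := ⟨G.1.comap Subtype.val, G.2.1.1.comap_of_neighborSet_eq_singleton G.2.2, fun x ↦ by
    rw [← ncard_neighborSet_attachLeaf, attachLeaf_comap G.2.2, G.2.1.2]⟩
  invFun H := ⟨attachLeaf v w H.1, ⟨attachLeaf_connected H.2.1, fun x ↦ by
    by_cases hx : x = v
    · rw [hx, neighborSet_attachLeaf_self, Set.ncard_singleton, hd]
    · rw [← H.2.2 ⟨x, hx⟩, ← ncard_neighborSet_attachLeaf]⟩, neighborSet_attachLeaf_self⟩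
  left_inv G := Subtype.ext (attachLeaf_comap G.2.2)
  right_inv H := Subtype.ext comap_attachLeaf

theorem Connected.ncard_neighborSet_pos [Finite V] [Nontrivial V] {G : SimpleGraph V}
    (hG : G.Connected) (x : V) : 0 < (G.neighborSet x).ncard := by
  classical
  have := Fintype.ofFinite V
  have := hG.preconnected.degree_pos_of_nontrivial x
  rwa [← card_neighborSet_eq_degree, ← Nat.card_eq_fintype_card, Nat.card_coe_set_eq] at this

theorem connected_and_ncard_neighborSet_eq_one_iff [Fintype V] (hV : Fintype.card V = 2)
    (G : SimpleGraph V) : (G.Connected ∧ ∀ x, (G.neighborSet x).ncard = 1) ↔ G = ⊤ := by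
  classical
  have : Nontrivial V := Fintype.one_lt_card_iff_nontrivial.1 (by lia)
  constructor
  · rintro ⟨-, hG⟩
    ext a b
    refine ⟨fun h ↦ h.ne, fun hab ↦ ?_⟩
    have hsub : G.neighborSet a ⊆ {a}ᶜ := by
      intro x hx
      exact (G.ne_of_adj hx).symm
    have heq := Set.eq_of_subset_of_ncard_le hsub (by
      rw [hG, Set.ncard_compl, Set.ncard_singleton, Nat.card_eq_fintype_card, hV])
    change b ∈ G.neighborSet a
    rw [heq]
    exact fun h ↦ hab h.symm
  · rintro rfl
    refine ⟨connected_top, fun x ↦ ?_⟩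
    rw [neighborSet_top, Set.ncard_compl, Set.ncard_singleton, Nat.card_eq_fintype_card, hV]

open Finset in
/-- The number of connected graphs on `n + 2` vertices with degrees `d x + 1`,
where `∑ x, d x = n`, is a multinomial coefficient. -/
theorem card_connected_mul_prod_factorial (n : ℕ) (V : Type) [Fintype V]
    (hV : Fintype.card V = n + 2) (d : V → ℕ) (hd : ∑ x, d x = n) :
    Nat.card {G : SimpleGraph V // G.Connected ∧ ∀ x, (G.neighborSet x).ncard = d x + 1} *
      ∏ x, (d x).factorial = n.factorial := by
  classical
  induction n generalizing V with
  | zero =>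
    have hd0 (x : V) : d x = 0 := by simpa using (sum_eq_zero_iff.1 hd) x (mem_univ x)
    simp only [hd0, zero_add, connected_and_ncard_neighborSet_eq_one_iff hV]
    simp
  | succ n ih =>
    obtain ⟨v, hv⟩ : ∃ v, d v = 0 := by
      by_contra! h
      have : ∑ _x : V, 1 ≤ ∑ x, d x := sum_le_sum fun x _ ↦ Nat.one_le_iff_ne_zero.2 (h x)
      simp at this
      lia
    have hcard : Fintype.card {x // x ≠ v} = n + 2 := by
      rw [Fintype.card_subtype_compl]
      simp [hV]
    have : Nontrivial {x // x ≠ v} := Fintype.one_lt_card_iff_nontrivial.1 (by lia)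
    have hprod : ∏ x, (d x).factorial = ∏ x : {x // x ≠ v}, (d x).factorial := by
      rw [Fintype.prod_eq_mul_prod_subtype_ne _ v, hv]
      simp
    have hsum : ∑ x : {x // x ≠ v}, d x = n + 1 := by
      rw [← hd, Fintype.sum_eq_add_sum_subtype_ne _ v, hv, zero_add]
    have hw (w : {x // x ≠ v}) :
        Nat.card {H : SimpleGraph {x // x ≠ v} // H.Connected ∧
          ∀ x, (H.neighborSet x).ncard + (if x = w then 1 else 0) = d x + 1} *
          ∏ x : {x // x ≠ v}, (d x).factorial = n.factorial * d w := by
      rcases Nat.eq_zero_or_pos (d w) with h0 | hpos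
      · have : IsEmpty {H : SimpleGraph {x // x ≠ v} // H.Connected ∧
            ∀ x, (H.neighborSet x).ncard + (if x = w then 1 else 0) = d x + 1} := by
          refine ⟨fun ⟨H, hH, hdeg⟩ ↦ ?_⟩
          have h₁ := hH.ncard_neighborSet_pos w
          have h₂ := hdeg w
          simp only [if_true] at h₂
          lia
        rw [Nat.card_of_isEmpty, h0, zero_mul, mul_zero]
      · let d' : {x // x ≠ v} → ℕ := fun x ↦ d x - if x = w then 1 else 0
        have hd' (x : {x // x ≠ v}) : d x = d' x + if x = w then 1 else 0 := by
          simp only [d']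
          split_ifs with hx
          · subst hx; lia
          · simp
        have hsum' : ∑ x, d' x = n := by
          simp_rw [hd', sum_add_distrib] at hsum
          simpa using hsum
        have hfact : ∏ x : {x // x ≠ v}, (d x).factorial = d w * ∏ x, (d' x).factorial := by
          rw [Fintype.prod_eq_mul_prod_subtype_ne _ w,
            Fintype.prod_eq_mul_prod_subtype_ne (fun x ↦ (d' x).factorial) w, ← mul_assoc]
          congr 1
          · simp [d', Nat.mul_factorial_pred hpos.ne']
          · refine prod_congr rfl fun x _ ↦ ?_
            simp [d', x.2]
        have hiff (H : SimpleGraph {x // x ≠ v}) (x : {x // x ≠ v}) :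
            (H.neighborSet x).ncard + (if x = w then 1 else 0) = d x + 1 ↔
              (H.neighborSet x).ncard = d' x + 1 := by
          rw [hd' x]
          lia
        simp only [hiff]
        rw [hfact, mul_left_comm, ih _ hcard d' hsum', mul_comm]
    let S := {G : SimpleGraph V // G.Connected ∧ ∀ x, (G.neighborSet x).ncard = d x + 1}
    have hnbr (G : S) : ∃ w : {x // x ≠ v}, G.1.neighborSet v = {(w : V)} := by
      obtain ⟨w, hw⟩ := Set.ncard_eq_one.1 ((G.2.2 v).trans (by rw [hv]))
      have : G.1.Adj v w := by simp [← mem_neighborSet, hw]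
      exact ⟨⟨w, this.ne'⟩, hw⟩
    choose nbr hnbr using hnbr
    have hnbr_iff (w) (G : S) : nbr G = w ↔ G.1.neighborSet v = {(w : V)} := by
      rw [hnbr, Set.singleton_eq_singleton_iff, Subtype.ext_iff]
    have hS : Nat.card S = ∑ w : {x // x ≠ v}, Nat.card {H : SimpleGraph {x // x ≠ v} //
        H.Connected ∧ ∀ x, (H.neighborSet x).ncard + (if x = w then 1 else 0) = d x + 1} := by
      rw [← Nat.card_congr (Equiv.sigmaFiberEquiv nbr), Nat.card_sigma]
      refine sum_congr rfl fun w _ ↦ Nat.card_congr ?_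
      exact ((Equiv.subtypeEquivRight (hnbr_iff w)).trans
        (Equiv.subtypeSubtypeEquivSubtypeInter
          (fun G : SimpleGraph V ↦ G.Connected ∧ ∀ x, (G.neighborSet x).ncard = d x + 1)
          fun G ↦ G.neighborSet v = {(w : V)})).trans (connectedLeafEquiv v w d hv)
    change Nat.card S * _ = _
    rw [hS, hprod, sum_mul, sum_congr rfl fun w _ ↦ hw w, ← mul_sum, hsum, Nat.factorial_succ,
      mul_comm]

/-- A connected graph whose degrees sum to twice the number of vertices minus two is acyclic. -/
theorem Connected.isAcyclic_of_sum_ncard_neighborSet [Fintype V] {G : SimpleGraph V}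
    (hG : G.Connected) (h : ∑ x, (G.neighborSet x).ncard + 2 = 2 * Fintype.card V) :
    G.IsAcyclic := by
  classical
  refine (isTree_iff_connected_and_card.2 ⟨hG, ?_⟩).isAcyclic
  have hsum := G.sum_degrees_eq_twice_card_edges
  have hdeg (x : V) : (G.neighborSet x).ncard = G.degree x := by
    rw [← card_neighborSet_eq_degree, ← Nat.card_eq_fintype_card, Nat.card_coe_set_eq]
  simp_rw [hdeg] at h
  rw [Nat.card_eq_fintype_card, Nat.card_eq_fintype_card, ← edgeFinset_card]
  lia

end SimpleGraph

/-- Weighted sums over values of a function in terms of the sizes of its fibres. -/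
@[to_additive]
theorem prod_comp_eq_prod_pow_card_fiber {V ι M : Type*} [Fintype V] [Fintype ι] [CommMonoid M]
    (c : V → ι) (f : ι → M) : ∏ v, f (c v) = ∏ i, f i ^ Nat.card {v // c v = i} := by
  classical
  rw [← Finset.prod_fiberwise' Finset.univ c f]
  refine Finset.prod_congr rfl fun i _ ↦ ?_
  rw [Finset.prod_const, Nat.card_eq_fintype_card, Fintype.card_subtype]

open SimpleGraph in
/-- The number of trees on `{1, ..., n}` in which exactly `α i` vertices have
degree `i` for each `i ∈ {1, ..., n-1}` (where `∑ αᵢ = n` and `∑ i·αᵢ = 2n-2`)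
is `(n! / ∏ αᵢ!) · ((n-2)! / ∏ ((i-1)!)^αᵢ)`.  Here the index `d : Fin (n-1)`
represents the degree `d + 1`. -/
theorem card_trees_with_degree_multiset (n : ℕ) (hn : 2 ≤ n) (α : Fin (n - 1) → ℕ)
    (h1 : ∑ i, α i = n) (h2 : ∑ i : Fin (n - 1), ((i : ℕ) + 1) * α i = 2 * n - 2) :
    Nat.card {G : SimpleGraph (Fin n) // G.Connected ∧ G.IsAcyclic ∧
        ∀ d : Fin (n - 1),
          Nat.card {v : Fin n // Nat.card (G.neighborSet v) = (d : ℕ) + 1} = α d}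
      = (n.factorial / ∏ i : Fin (n - 1), (α i).factorial) *
        ((n - 2).factorial / ∏ i : Fin (n - 1), ((i : ℕ).factorial) ^ α i) := by
  have hsumc (c : Fin n → Fin (n - 1)) (hc : ∀ i, Nat.card {v // c v = i} = α i) :
      ∑ v, (c v : ℕ) = n - 2 := by
    rw [sum_comp_eq_sum_nsmul_card_fiber c (fun i ↦ (i : ℕ))]
    simp_rw [add_mul, Finset.sum_add_distrib, one_mul, h1] at h2
    simp_rw [hc, smul_eq_mul, mul_comm (α _)]
    lia
  have : Nontrivial (Fin n) := Fin.nontrivial_iff_two_le.2 hn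
  let e : {G : SimpleGraph (Fin n) // G.Connected ∧ G.IsAcyclic ∧
        ∀ d : Fin (n - 1),
          Nat.card {v : Fin n // Nat.card (G.neighborSet v) = (d : ℕ) + 1} = α d} ≃
      Σ c : {c : Fin n → Fin (n - 1) // ∀ i, Nat.card {v // c v = i} = α i},
        {G : SimpleGraph (Fin n) // G.Connected ∧
          ∀ v, (G.neighborSet v).ncard = (c.1 v : ℕ) + 1} :=
    { toFun := fun G ↦
        have hpos (v : Fin n) : 0 < (G.1.neighborSet v).ncard := G.2.1.ncard_neighborSet_pos v
        have hlt (v : Fin n) : (G.1.neighborSet v).ncard - 1 < n - 1 := by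
          have := Set.ncard_lt_ncard (s := G.1.neighborSet v) (t := Set.univ)
            ((Set.ssubset_univ_iff).2 fun h ↦ G.1.irrefl (v := v) (by
              rw [← mem_neighborSet, h]; trivial))
          rw [Set.ncard_univ, Nat.card_fin] at this
          have := hpos v
          lia
        ⟨⟨fun v ↦ ⟨(G.1.neighborSet v).ncard - 1, hlt v⟩, fun i ↦ by
          rw [← G.2.2.2 i]
          refine Nat.card_congr (Equiv.subtypeEquivRight fun v ↦ ?_)
          have := hpos v
          rw [Nat.card_coe_set_eq, Fin.ext_iff]
          simp only
          lia⟩, G.1, G.2.1, fun v ↦ (Nat.sub_add_cancel (hpos v)).symm⟩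
      invFun := fun p ↦ ⟨p.2.1, p.2.2.1, p.2.2.1.isAcyclic_of_sum_ncard_neighborSet (by
          simp_rw [p.2.2.2, Finset.sum_add_distrib, hsumc p.1.1 p.1.2]
          simp
          lia), fun d ↦ by
          simp_rw [← p.1.2 d, Nat.card_coe_set_eq, p.2.2.2, Nat.add_right_cancel_iff, Fin.ext_iff]⟩
      left_inv := fun G ↦ rfl
      right_inv := by
        rintro ⟨⟨c, hc⟩, G, hG, hdeg⟩
        refine Sigma.subtype_ext (Subtype.ext (funext fun v ↦ Fin.ext ?_)) rfl
        simp [hdeg] }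
  have hcount (c : {c : Fin n → Fin (n - 1) // ∀ i, Nat.card {v // c v = i} = α i}) :
      Nat.card {G : SimpleGraph (Fin n) // G.Connected ∧
          ∀ v, (G.neighborSet v).ncard = (c.1 v : ℕ) + 1} =
        (n - 2).factorial / ∏ i : Fin (n - 1), ((i : ℕ).factorial) ^ α i := by
    have h := card_connected_mul_prod_factorial (n - 2) (Fin n) (by simp; lia)
      (fun v ↦ (c.1 v : ℕ)) (hsumc c.1 c.2)
    rw [prod_comp_eq_prod_pow_card_fiber c.1 (fun i ↦ (i : ℕ).factorial)] at h
    simp_rw [c.2] at h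
    exact (Nat.div_eq_of_eq_mul_left
      (Finset.prod_pos fun i _ ↦ pow_pos (Nat.factorial_pos _) _) h.symm).symm
  have hfun := card_functions_with_fiber_cards (V := Fin n) α (by simpa using h1)
  rw [Fintype.card_fin] at hfun
  rw [Nat.card_congr e, Nat.card_sigma, Finset.sum_congr rfl fun c _ ↦ hcount c,
    Finset.sum_const, Finset.card_univ, ← Nat.card_eq_fintype_card, smul_eq_mul,
    Nat.div_eq_of_eq_mul_left (Finset.prod_pos fun i _ ↦ Nat.factorial_pos _) hfun.symm]
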